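/- For all m ≥ 1, all h_m ∈ H_m^{p*}, all i ∈ {1, …, r}, and all k ∈ B^i[h_m], the h_m-shift satisfies γ^k_∞(σ[h_m]) = γ^i_∞. Consequently, the sets B¹[h_m], …, B^r[h_m] are pairwise disjoint. -/

import Mathlib

open MeasureTheory Filter

namespace PomdpPaper

/-- A belief (probability vector) on `Fin n`. -/
def IsBelief {n : ℕ} (p : Fin n → ℝ) : Prop :=
  (∀ k, 0 ≤ p k) ∧ ∑ k, p k = 1

/-- The measure on a finite type associated with a probability vector. -/
noncomputable def vecMeasure {α : Type*} [Fintype α] [MeasurableSpace α] (p : α → ℝ) :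
    Measure α :=
  ∑ x : α, ENNReal.ofReal (p x) • Measure.dirac x

/-- The Dirac belief at a point. -/
def diracBelief {n : ℕ} (k : Fin n) : Fin n → ℝ := fun k' => if k' = k then 1 else 0

/-- The `i`-th binary digit of a real number `x ∈ [0,1)` (as a real number `0` or `1`). -/
noncomputable def digitR (x : ℝ) (i : ℕ) : ℝ :=
  if ⌊x * 2 ^ (i + 1)⌋ % 2 = 1 then 1 else 0

/-- From one uniform seed `x ∈ [0,1)`, a sequence `unif x 0, unif x 1, …` of
(independent, uniformly distributed on `[0,1]`) real numbers, obtained by splitting the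
binary digits of `x` along the pairing function. -/
noncomputable def unif (x : ℝ) (m : ℕ) : ℝ :=
  ∑' j : ℕ, digitR x (Nat.pair m j) / 2 ^ (j + 1)

open Classical in
/-- Inverse-transform sampling from a probability vector on `Fin n` using a seed `u ∈ [0,1]`. -/
noncomputable def sampleFin {n : ℕ} (hn : 0 < n) (p : Fin n → ℝ) (u : ℝ) : Fin n :=
  let s : Finset (Fin n) :=
    Finset.univ.filter fun y : Fin n => u < ∑ z ∈ Finset.univ.filter fun z : Fin n => z ≤ y, p z
  if hs : s.Nonempty then s.min' hs else ⟨0, hn⟩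

/-- Inverse-transform sampling from a probability vector on a finite nonempty type. -/
noncomputable def sampleOn {β : Type*} [Fintype β] [Nonempty β] (p : β → ℝ) (u : ℝ) : β :=
  (Fintype.equivFin β).symm
    (sampleFin Fintype.card_pos (fun i => p ((Fintype.equivFin β).symm i)) u)

/-- A POMDP with states `Fin nK`, actions `Fin nA`, signals `Fin nS`, transition function `q`
and reward function `g` with values in `[0,1]`. -/
structure POMDP where
  nK : ℕ
  nA : ℕ
  nS : ℕ
  hK : 0 < nK
  hA : 0 < nA
  hS : 0 < nS
  q : Fin nK → Fin nA → Fin nK × Fin nS → ℝ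
  q_nonneg : ∀ k a y, 0 ≤ q k a y
  q_sum : ∀ k a, ∑ y, q k a y = 1
  g : Fin nK → Fin nA → ℝ
  g_nonneg : ∀ k a, 0 ≤ g k a
  g_le_one : ∀ k a, g k a ≤ 1

namespace POMDP

variable (Γ : POMDP)

/-- The state space. -/
abbrev K := Fin Γ.nK
/-- The action space. -/
abbrev A := Fin Γ.nA
/-- The signal space. -/
abbrev S := Fin Γ.nS

instance : Nonempty Γ.K := ⟨⟨0, Γ.hK⟩⟩
instance : Nonempty Γ.A := ⟨⟨0, Γ.hA⟩⟩
instance : Nonempty Γ.S := ⟨⟨0, Γ.hS⟩⟩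

/-- A history: the finite sequence of past actions and signals. -/
abbrev Hist := List (Γ.A × Γ.S)

/-- A (pure) strategy: a map from histories to actions. -/
abbrev Strategy := Γ.Hist → Γ.A

/-- The sample space carrying all the randomness: an initial state together with a
uniform seed in `[0,1)` used to draw all the transitions. -/
abbrev Env := Γ.K × ℝ

/-- The probability measure on the sample space induced by the initial belief `p1`:
the initial state is drawn according to `p1`, the seed uniformly on `[0,1)`. -/
noncomputable def envMeasure (p1 : Γ.K → ℝ) : Measure Γ.Env :=
  (vecMeasure p1).prod (volume.restrict (Set.Ico (0 : ℝ) 1))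

/-- The trajectory: `(Γ.traj σ ω m).1` is the state `k_{m+1}` at stage `m+1` and
`(Γ.traj σ ω m).2` is the history before stage `m+1` (of length `m`), when the
decision-maker uses strategy `σ` and the randomness is `ω`.  At each stage, the pair
(new state, signal) is drawn from `q` via inverse-transform sampling from a fresh
uniform variable. -/
noncomputable def traj (σ : Γ.Strategy) (ω : Γ.Env) : ℕ → Γ.K × Γ.Hist
  | 0 => (ω.1, [])
  | m + 1 =>
    let p := traj σ ω m
    let a := σ p.2
    let y := sampleOn (Γ.q p.1 a) (unif ω.2 m)
    (y.1, p.2 ++ [(a, y.2)])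

/-- The state `k_{m+1}` at stage `m+1` (`m` is 0-indexed). -/
noncomputable def state (σ : Γ.Strategy) (ω : Γ.Env) (m : ℕ) : Γ.K := (Γ.traj σ ω m).1

/-- The history before stage `m+1` (a list of length `m`). -/
noncomputable def hist (σ : Γ.Strategy) (ω : Γ.Env) (m : ℕ) : Γ.Hist := (Γ.traj σ ω m).2

/-- The action `a_{m+1}` played at stage `m+1`. -/
noncomputable def act (σ : Γ.Strategy) (ω : Γ.Env) (m : ℕ) : Γ.A := σ (Γ.hist σ ω m)

/-- The reward `g_{m+1}` obtained at stage `m+1`. -/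
noncomputable def rew (σ : Γ.Strategy) (ω : Γ.Env) (m : ℕ) : ℝ :=
  Γ.g (Γ.state σ ω m) (Γ.act σ ω m)

/-- The average reward over the first `n` stages. -/
noncomputable def avg (σ : Γ.Strategy) (ω : Γ.Env) (n : ℕ) : ℝ :=
  (1 / n : ℝ) * ∑ m ∈ Finset.range n, Γ.rew σ ω m

/-- The probability of an event under initial belief `p1` (the strategy `σ` is recorded for
readability; the underlying measure does not depend on it). -/
noncomputable def prob (p1 : Γ.K → ℝ) (_σ : Γ.Strategy) (E : Set Γ.Env) : ℝ :=
  (Γ.envMeasure p1 E).toReal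

/-- The long-run average payoff `γ^{p1}_∞(σ) = E[liminf (1/n) ∑ g_m]`. -/
noncomputable def pay (p1 : Γ.K → ℝ) (σ : Γ.Strategy) : ℝ :=
  ∫ ω, atTop.liminf (Γ.avg σ ω) ∂(Γ.envMeasure p1)

/-- The payoff starting from a deterministic state `k`, i.e. `γ^k_∞(σ)`. -/
noncomputable def payK (k : Γ.K) (σ : Γ.Strategy) : ℝ := Γ.pay (diracBelief k) σ

/-- The value `v_∞(p1)`. -/
noncomputable def val (p1 : Γ.K → ℝ) : ℝ := ⨆ σ : Γ.Strategy, Γ.pay p1 σ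

/-- A strategy has finite memory if it is implemented by a finite-state transducer. -/
def FiniteMemory (σ : Γ.Strategy) : Prop :=
  ∃ (n : ℕ) (m0 : Fin n) (σa : Fin n → Γ.A) (σu : Fin n → Γ.A × Γ.S → Fin n),
    ∀ h : Γ.Hist, σ h = σa (h.foldl σu m0)

/-- A blind MDP: the signal set is a singleton. -/
def Blind : Prop := Γ.nS = 1

/-- The strategy induced by a sequence of actions `a_1, a_2, …` (`as m` is the action played
at stage `m+1`, regardless of the observed history). -/
def blindStrat (as : ℕ → Γ.A) : Γ.Strategy := fun h => as h.length

end POMDP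

/-- A sequence is eventually periodic if it is periodic with some period `T ≥ 1` from
some stage `N` on. -/
def EventuallyPeriodic {α : Type*} (as : ℕ → α) : Prop :=
  ∃ T ≥ 1, ∃ N ≥ 1, ∀ m ≥ N, as (m + T) = as m


namespace POMDP

variable (Γ : POMDP)

/-- `Γ.histProb p1 σ h` is the probability, under initial belief `p1` and strategy `σ`,
that the history before stage `h.length + 1` equals `h`. -/
noncomputable def histProb (p1 : Γ.K → ℝ) (σ : Γ.Strategy) (h : Γ.Hist) : ℝ :=
  Γ.prob p1 σ {ω | Γ.hist σ ω h.length = h}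

/-- The belief at stage `h.length + 1` given the history `h`:
`p_m(k) = P(k_m = k | h_m = h)` (defined via Bayes rule, i.e. as a quotient). -/
noncomputable def belief (p1 : Γ.K → ℝ) (σ : Γ.Strategy) (h : Γ.Hist) : Γ.K → ℝ :=
  fun k =>
    Γ.prob p1 σ {ω | Γ.hist σ ω h.length = h ∧ Γ.state σ ω h.length = k} /
      Γ.histProb p1 σ h

end POMDP

namespace POMDP

variable (Γ : POMDP)

/-- The `h`-shift of a strategy: `σ[h](h') = σ(h, h')`. -/
def shiftStrat (σ : Γ.Strategy) (h : Γ.Hist) : Γ.Strategy := fun h' => σ (h ++ h')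

/-- `Γ.condStateProb k σ h k'` is the conditional probability
`P^k_σ(k_{m} = k' | h_m = h)` where `m = h.length + 1`. -/
noncomputable def condStateProb (k : Γ.K) (σ : Γ.Strategy) (h : Γ.Hist) (k' : Γ.K) : ℝ :=
  Γ.prob (diracBelief k) σ
      {ω | Γ.hist σ ω h.length = h ∧ Γ.state σ ω h.length = k'} /
    Γ.prob (diracBelief k) σ {ω | Γ.hist σ ω h.length = h}

/-- The super-support after history `h` associated with the classes `Kc`:
`Γ.superSuppH σ Kc h i` is the set of states reached with positive probability after
history `h`, under `σ` and starting from a state in `Kc i`. -/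
noncomputable def superSuppH (σ : Γ.Strategy) {r : ℕ} (Kc : Fin r → Finset Γ.K)
    (h : Γ.Hist) (i : Fin r) : Set Γ.K :=
  {k' | ∃ k ∈ Kc i, 0 < Γ.condStateProb k σ h k'}

end POMDP

open ProbabilityTheory

noncomputable abbrev lam : Measure ℝ := volume.restrict (Set.Ico (0 : ℝ) 1)

instance lam_prob : IsProbabilityMeasure lam := ⟨by simp [lam]⟩

theorem measurable_digitR (i : ℕ) : Measurable (fun x => digitR x i) := by
  unfold digitR
  refine Measurable.ite ?_ measurable_const measurable_const
  have h : Measurable (fun x : ℝ => ⌊x * 2 ^ (i + 1)⌋) :=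
    Int.measurable_floor.comp (measurable_id.mul_const _)
  exact h (MeasurableSet.of_discrete (s := {z : ℤ | z % 2 = 1}))

theorem digitR_fract (x : ℝ) (i : ℕ) : digitR (Int.fract (2 * x)) i = digitR x (i + 1) := by
  unfold digitR
  have h : Int.fract (2 * x) * 2 ^ (i + 1)
      = x * 2 ^ (i + 1 + 1) - ((⌊2 * x⌋ * 2 ^ (i + 1) : ℤ) : ℝ) := by
    rw [Int.fract]; push_cast; ring
  have h2 : (⌊2 * x⌋ * 2 ^ (i + 1) : ℤ) = 2 * (⌊2 * x⌋ * 2 ^ i) := by ring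
  rw [h, Int.floor_sub_intCast, h2]
  congr 1
  apply propext
  omega

theorem lam_half0 (B : Set ℝ) :
    volume (Set.Ico (0 : ℝ) (1/2) ∩ (fun x => Int.fract (2 * x)) ⁻¹' B)
      = 2⁻¹ * lam B := by
  rw [lam, Measure.restrict_apply' measurableSet_Ico]
  have : Set.Ico (0 : ℝ) (1/2) ∩ (fun x => Int.fract (2 * x)) ⁻¹' B
      = (fun x => 2 * x) ⁻¹' (B ∩ Set.Ico 0 1) := by
    ext x
    simp only [Set.mem_inter_iff, Set.mem_Ico, Set.mem_preimage]
    constructor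
    · rintro ⟨⟨h0, h1⟩, h2⟩
      rw [Int.fract_eq_self.2 ⟨by linarith, by linarith⟩] at h2
      exact ⟨h2, by linarith, by linarith⟩
    · rintro ⟨h2, h0, h1⟩
      rw [Int.fract_eq_self.2 ⟨by linarith, by linarith⟩]
      exact ⟨⟨by linarith, by linarith⟩, h2⟩
  rw [this, Real.volume_preimage_mul_left (by norm_num)]
  congr 1
  rw [abs_of_pos (by norm_num), ENNReal.ofReal_inv_of_pos (by norm_num)]
  simp

theorem lam_half1 (B : Set ℝ) :
    volume (Set.Ico (1/2 : ℝ) 1 ∩ (fun x => Int.fract (2 * x)) ⁻¹' B)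
      = 2⁻¹ * lam B := by
  rw [← lam_half0]
  rw [← measure_preimage_add_right volume (1/2)]
  congr 1
  ext x
  simp only [Set.mem_inter_iff, Set.mem_Ico, Set.mem_preimage]
  have : Int.fract (2 * (x + 1/2)) = Int.fract (2 * x) := by
    rw [show 2 * (x + 1/2) = 2 * x + 1 by ring, Int.fract_add_one]
  rw [this]
  constructor
  · rintro ⟨⟨h0, h1⟩, h2⟩
    exact ⟨⟨by linarith, by linarith⟩, h2⟩
  · rintro ⟨⟨h0, h1⟩, h2⟩
    exact ⟨⟨by linarith, by linarith⟩, h2⟩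

theorem digitR_zero_lo {x : ℝ} (h : x ∈ Set.Ico (0 : ℝ) (1/2)) : digitR x 0 = 0 := by
  have : ⌊x * 2 ^ (0 + 1)⌋ = 0 := by
    rw [Int.floor_eq_iff]; constructor <;> norm_num <;> linarith [h.1, h.2]
  unfold digitR
  rw [this]; simp

theorem digitR_zero_hi {x : ℝ} (h : x ∈ Set.Ico (1/2 : ℝ) 1) : digitR x 0 = 1 := by
  have : ⌊x * 2 ^ (0 + 1)⌋ = 1 := by
    rw [Int.floor_eq_iff]; constructor <;> norm_num <;> linarith [h.1, h.2]
  unfold digitR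
  rw [this]; simp

open Classical in
/-- weight of a set under the fair coin -/
noncomputable def coinW (t : Set ℝ) : ENNReal :=
  (if (0:ℝ) ∈ t then 2⁻¹ else 0) + (if (1:ℝ) ∈ t then 2⁻¹ else 0)

theorem lam_step (t B : Set ℝ) :
    lam ({x | digitR x 0 ∈ t} ∩ (fun x => Int.fract (2 * x)) ⁻¹' B) = coinW t * lam B := by
  set A := {x | digitR x 0 ∈ t} ∩ (fun x => Int.fract (2 * x)) ⁻¹' B with hA
  have hd : Set.Ico (0 : ℝ) 1 = Set.Ico (0 : ℝ) (1/2) ∪ Set.Ico (1/2 : ℝ) 1 :=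
    (Set.Ico_union_Ico_eq_Ico (by norm_num) (by norm_num)).symm
  have h0 : volume (A ∩ Set.Ico (0 : ℝ) (1/2)) = (open Classical in if (0:ℝ) ∈ t then 2⁻¹ else 0) * lam B := by
    split_ifs with h
    · rw [← lam_half0]; congr 1; ext x; simp only [hA, Set.mem_inter_iff, Set.mem_ofPred_eq]
      constructor
      · tauto
      · rintro ⟨a, b⟩; exact ⟨⟨by rw [digitR_zero_lo a]; exact h, b⟩, a⟩
    · rw [zero_mul]
      have : A ∩ Set.Ico (0 : ℝ) (1/2) = ∅ := by
        ext x; simp only [hA, Set.mem_inter_iff, Set.mem_ofPred_eq, Set.mem_empty_iff_false, iff_false]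
        rintro ⟨⟨a, _⟩, c⟩; rw [digitR_zero_lo c] at a; exact h a
      rw [this, measure_empty]
  have h1 : volume (A ∩ Set.Ico (1/2 : ℝ) 1) = (open Classical in if (1:ℝ) ∈ t then 2⁻¹ else 0) * lam B := by
    split_ifs with h
    · rw [← lam_half1]; congr 1; ext x; simp only [hA, Set.mem_inter_iff, Set.mem_ofPred_eq]
      constructor
      · tauto
      · rintro ⟨a, b⟩; exact ⟨⟨by rw [digitR_zero_hi a]; exact h, b⟩, a⟩
    · rw [zero_mul]
      have : A ∩ Set.Ico (1/2 : ℝ) 1 = ∅ := by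
        ext x; simp only [hA, Set.mem_inter_iff, Set.mem_ofPred_eq, Set.mem_empty_iff_false, iff_false]
        rintro ⟨⟨a, _⟩, c⟩; rw [digitR_zero_hi c] at a; exact h a
      rw [this, measure_empty]
  have hdj : Disjoint (Set.Ico (0 : ℝ) (1/2)) (Set.Ico (1/2 : ℝ) 1) :=
    Set.disjoint_left.2 fun x a b => absurd a.2 (not_lt.2 b.1)
  have : lam A = volume.restrict (Set.Ico (0 : ℝ) (1/2)) A + volume.restrict (Set.Ico (1/2 : ℝ) 1) A := by
    rw [lam, hd, Measure.restrict_union hdj measurableSet_Ico, Measure.add_apply]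
  rw [this, Measure.restrict_apply' measurableSet_Ico, Measure.restrict_apply' measurableSet_Ico,
    h0, h1, coinW, add_mul]

theorem lam_cyl (n : ℕ) (t : ℕ → Set ℝ) :
    lam {x | ∀ i < n, digitR x i ∈ t i} = ∏ i ∈ Finset.range n, coinW (t i) := by
  induction n generalizing t with
  | zero => simp
  | succ n ih =>
    rw [Finset.prod_range_succ', ← ih (fun i => t (i + 1)), mul_comm, ← lam_step]
    congr 1
    ext x
    simp only [Set.mem_inter_iff, Set.mem_ofPred_eq, Set.mem_preimage, digitR_fract]
    constructor
    · intro h; exact ⟨h 0 (by omega), fun i hi => h (i + 1) (by omega)⟩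
    · rintro ⟨h0, h1⟩ i hi
      cases i with
      | zero => exact h0
      | succ i => exact h1 i (by omega)

theorem coinW_univ : coinW Set.univ = 1 := by
  simp [coinW, ENNReal.inv_two_add_inv_two]

theorem lam_cyl_finset (S : Finset ℕ) (t : ℕ → Set ℝ) :
    lam (⋂ i ∈ S, (fun x => digitR x i) ⁻¹' t i) = ∏ i ∈ S, coinW (t i) := by
  classical
  obtain ⟨n, hn⟩ : ∃ n, S ⊆ Finset.range n := S.exists_nat_subset_range
  have := lam_cyl n (fun i => if i ∈ S then t i else Set.univ)
  rw [← Finset.prod_subset hn] at this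
  · rw [Finset.prod_congr rfl (g := fun i => coinW (t i))] at this
    · rw [← this]
      congr 1
      ext x
      simp only [Set.mem_iInter, Set.mem_preimage, Set.mem_ofPred_eq]
      constructor
      · intro h i _
        split_ifs with hi
        · exact h i hi
        · trivial
      · intro h i hi
        have := h i (Finset.mem_range.1 (hn hi))
        simpa [hi] using this
    · intro i hi; simp [hi]
  · intro i _ hi; simp [hi, coinW_univ]

theorem lam_digit (i : ℕ) (t : Set ℝ) : lam ((fun x => digitR x i) ⁻¹' t) = coinW t := by
  simpa using lam_cyl_finset {i} (fun _ => t)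

theorem iIndep_digit : iIndepFun (fun i x => digitR x i) lam := by
  rw [iIndepFun_iff_measure_inter_preimage_eq_mul]
  intro S sets _
  rw [lam_cyl_finset]
  exact Finset.prod_congr rfl fun i _ => (lam_digit i _).symm

theorem map_digit_reindex (e : ℕ → ℕ) (he : Function.Injective e) :
    lam.map (fun x i => digitR x (e i)) = lam.map (fun x i => digitR x i) := by
  rw [(iIndep_digit.precomp he).map_fun_eq_infinitePi_map (fun i => measurable_digitR _),
    iIndep_digit.map_fun_eq_infinitePi_map (fun i => measurable_digitR _)]
  congr 1
  funext i
  ext t ht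
  rw [Measure.map_apply (measurable_digitR _) ht, Measure.map_apply (measurable_digitR _) ht,
    lam_digit, lam_digit]

/-- the uniform sequence from a digit sequence -/
noncomputable def digU (d : ℕ → ℝ) (m : ℕ) : ℝ :=
  ∑' j : ℕ, (if d (Nat.pair m j) = 1 then 1 else 0) / 2 ^ (j + 1)

theorem unif_eq (x : ℝ) (e : ℕ → ℕ) (m m' : ℕ)
    (h : ∀ j, e (Nat.pair m j) = Nat.pair m' j) :
    digU (fun i => digitR x (e i)) m = unif x m' := by
  unfold digU unif
  refine tsum_congr fun j => ?_
  beta_reduce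
  rw [h]; unfold digitR; split_ifs <;> simp_all

theorem measurable_tsum_aux {Ω : Type*} [MeasurableSpace Ω] (f : ℕ → Ω → ℝ)
    (hf : ∀ j, Measurable (f j)) :
    Measurable (fun x => ∑' j : ℕ, (if f j x = 1 then (1:ℝ) else 0) / 2 ^ (j + 1)) := by
  have hs : ∀ x, Summable (fun j : ℕ => (if f j x = 1 then (1:ℝ) else 0) / 2 ^ (j + 1)) := by
    intro x
    refine Summable.of_nonneg_of_le (fun j => by positivity) (fun j => ?_)
      (summable_geometric_two' 1)
    have : (if f j x = 1 then (1:ℝ) else 0) ≤ 1 := by split_ifs <;> norm_num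
    rw [div_div, pow_succ, mul_comm (2:ℝ)]
    gcongr
  refine measurable_of_tendsto_metrizable (f := fun n x => ∑ j ∈ Finset.range n, (if f j x = 1 then (1:ℝ) else 0) / 2 ^ (j + 1)) (fun n => ?_) ?_
  · refine Finset.measurable_sum _ fun j _ => Measurable.div_const ?_ _
    exact Measurable.ite ((hf j) (measurableSet_singleton 1)) measurable_const measurable_const
  · rw [tendsto_pi_nhds]
    intro x
    exact (hs x).hasSum.tendsto_sum_nat

theorem measurable_digU : Measurable digU := by
  rw [measurable_pi_iff]
  intro m
  exact measurable_tsum_aux (fun j (d : ℕ → ℝ) => d (Nat.pair m j)) (fun j => measurable_pi_apply _)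

/-- sigma-algebra generated by the digits used in rows in `S`. -/
noncomputable abbrev rowAlg (R : Set ℕ) : MeasurableSpace ℝ :=
  ⨆ i ∈ {i : ℕ | (Nat.unpair i).1 ∈ R}, MeasurableSpace.comap (fun x => digitR x i) inferInstance

theorem unif_rowAlg (R : Set ℕ) (m : ℕ) (hm : m ∈ R) :
    Measurable[rowAlg R] (fun x => unif x m) := by
  have : (fun x => unif x m) = fun x => ∑' j : ℕ, (if digitR x (Nat.pair m j) = 1 then (1:ℝ) else 0) / 2 ^ (j + 1) := by
    funext x; exact (unif_eq x id m m (fun _ => rfl)).symm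
  rw [this]
  refine @measurable_tsum_aux ℝ (rowAlg R) (fun j x => digitR x (Nat.pair m j)) (fun j => ?_)
  refine Measurable.mono (comap_measurable _) ?_ le_rfl
  exact le_iSup₂_of_le (f := fun (i : ℕ) (_ : i ∈ {i : ℕ | (Nat.unpair i).1 ∈ R}) => MeasurableSpace.comap (fun x => digitR x i) inferInstance) (Nat.pair m j) (by simpa using hm) le_rfl

theorem indep_rows (R T : Set ℕ) (h : Disjoint R T) : Indep (rowAlg R) (rowAlg T) lam := by
  refine indep_iSup_of_disjoint (fun i => (measurable_digitR i).comap_le) iIndep_digit ?_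
  rw [Set.disjoint_left] at h ⊢
  intro i a b
  exact h a b

theorem map_unif_shift (M : ℕ) :
    lam.map (fun x m => unif x (M + m)) = lam.map (fun x => unif x) := by
  let e : ℕ → ℕ := fun i => Nat.pair (M + (Nat.unpair i).1) (Nat.unpair i).2
  have he : Function.Injective e := by
    intro i j hij
    simp only [e, Nat.pair_eq_pair] at hij
    rw [← Nat.pair_unpair i, ← Nat.pair_unpair j, hij.2, Nat.add_left_cancel hij.1]
  have h1 : (fun (x : ℝ) m => unif x (M + m)) = digU ∘ (fun x i => digitR x (e i)) := by
    funext x m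
    exact (unif_eq x e m (M + m) (fun j => by simp [e])).symm
  have h2 : (fun (x : ℝ) => unif x) = digU ∘ (fun x i => digitR x i) := by
    funext x m
    exact (unif_eq x id m m (fun j => rfl)).symm
  rw [h1, h2, ← Measure.map_map measurable_digU, ← Measure.map_map measurable_digU,
    map_digit_reindex e he]
  · exact measurable_pi_iff.2 fun i => measurable_digitR i
  · exact measurable_pi_iff.2 fun i => measurable_digitR _

theorem measurableSet_preimage_countable {Ω α : Type*} [MeasurableSpace Ω] [Countable α]
    (f : Ω → α) (hf : ∀ c, MeasurableSet {x | f x = c}) (s : Set α) :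
    MeasurableSet (f ⁻¹' s) := by
  have : f ⁻¹' s = ⋃ c ∈ s, {x | f x = c} := by
    ext x; simp
  rw [this]
  exact MeasurableSet.biUnion (Set.to_countable s) fun c _ => hf c

theorem measurableSet_sampleOn {β : Type*} [Fintype β] [Nonempty β] (p : β → ℝ) (s : Set β) :
    MeasurableSet {v : ℝ | sampleOn p v ∈ s} := by
  classical
  let n := Fintype.card β
  let P : Fin n → ℝ := fun i => p ((Fintype.equivFin β).symm i)
  let T : ℝ → Fin n → Prop :=
    fun v y => v < ∑ z ∈ Finset.univ.filter fun z : Fin n => z ≤ y, P z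
  let F : (Fin n → Prop) → β := fun b =>
    (Fintype.equivFin β).symm
      (if hs : (Finset.univ.filter fun y : Fin n => b y).Nonempty then
        (Finset.univ.filter fun y : Fin n => b y).min' hs else ⟨0, Fintype.card_pos⟩)
  have hT : Measurable T := by
    rw [measurable_pi_iff]
    intro y
    exact measurableSet_setOfPred.1 (measurableSet_Iio (a := ∑ z ∈ Finset.univ.filter fun z : Fin n => z ≤ y, P z))
  have hF : ∀ v, sampleOn p v = F (T v) := by
    intro v
    simp only [sampleOn, sampleFin, F, T, P]
    congr!
  have h2 : {v : ℝ | sampleOn p v ∈ s} = T ⁻¹' (F ⁻¹' s) := by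
    ext v
    simp only [Set.mem_ofPred_eq, Set.mem_preimage, hF]
  rw [h2]
  exact hT (Set.toFinite _).measurableSet

namespace POMDP

variable (Γ : POMDP)

/-- One transition step, driven by the number `v`. -/
noncomputable def stepU (σ : Γ.Strategy) (c : Γ.K × Γ.Hist) (v : ℝ) : Γ.K × Γ.Hist :=
  ((sampleOn (Γ.q c.1 (σ c.2)) v).1,
    c.2 ++ [(σ c.2, (sampleOn (Γ.q c.1 (σ c.2)) v).2)])

/-- Trajectory driven by a sequence. -/
noncomputable def trajU (σ : Γ.Strategy) (k : Γ.K) (u : ℕ → ℝ) : ℕ → Γ.K × Γ.Hist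
  | 0 => (k, [])
  | m + 1 => Γ.stepU σ (trajU σ k u m) (u m)

theorem traj_eq_trajU (σ : Γ.Strategy) (k : Γ.K) (x : ℝ) (m : ℕ) :
    Γ.traj σ (k, x) m = Γ.trajU σ k (unif x) m := by
  induction m with
  | zero => rfl
  | succ m ih => simp only [traj, trajU, stepU, ih]

/-- average reward driven by a sequence -/
noncomputable def avgU (σ : Γ.Strategy) (k : Γ.K) (u : ℕ → ℝ) (n : ℕ) : ℝ :=
  (1 / n : ℝ) * ∑ m ∈ Finset.range n, Γ.g (Γ.trajU σ k u m).1 (σ (Γ.trajU σ k u m).2)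

theorem avg_eq_avgU (σ : Γ.Strategy) (k : Γ.K) (x : ℝ) :
    Γ.avg σ (k, x) = Γ.avgU σ k (unif x) := by
  funext n
  simp only [avg, avgU, rew, act, state, hist, traj_eq_trajU]

theorem measurableSet_trajU {Ω : Type*} [MeasurableSpace Ω] (σ : Γ.Strategy) (k : Γ.K)
    (u : Ω → ℕ → ℝ) (M : ℕ) (hu : ∀ m < M, Measurable (fun x => u x m)) (s : Set (Γ.K × Γ.Hist)) :
    MeasurableSet ((fun x => Γ.trajU σ k (u x) M) ⁻¹' s) := by
  induction M generalizing s with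
  | zero =>
    exact MeasurableSet.const ((k, []) ∈ s)
  | succ M ih =>
    have h1 : (fun x => Γ.trajU σ k (u x) (M + 1)) ⁻¹' s
        = ⋃ c : Γ.K × Γ.Hist, ((fun x => Γ.trajU σ k (u x) M) ⁻¹' {c}) ∩
          (fun x => u x M) ⁻¹' {v | Γ.stepU σ c v ∈ s} := by
      ext x
      simp [trajU]
    rw [h1]
    refine MeasurableSet.iUnion fun c => MeasurableSet.inter
      (ih (fun m hm => hu m (by omega)) _) (hu M (by omega) ?_)
    exact measurableSet_sampleOn (Γ.q c.1 (σ c.2))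
      {y | (y.1, c.2 ++ [(σ c.2, y.2)]) ∈ s}

theorem measurable_avgU (σ : Γ.Strategy) (k : Γ.K) (n : ℕ) :
    Measurable (fun u => Γ.avgU σ k u n) := by
  unfold avgU
  refine Measurable.const_mul (Finset.measurable_sum _ fun m _ => ?_) _
  intro s _
  exact Γ.measurableSet_trajU σ k (fun u => u) m (fun j _ => measurable_pi_apply j)
    {c | Γ.g c.1 (σ c.2) ∈ s}

theorem trajU_shift (σ : Γ.Strategy) (k k' : Γ.K) (h : Γ.Hist) (u : ℕ → ℝ) (M : ℕ)
    (hM : Γ.trajU σ k u M = (k', h)) (n : ℕ) :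
    Γ.trajU σ k u (M + n) =
      ((Γ.trajU (Γ.shiftStrat σ h) k' (fun m => u (M + m)) n).1,
        h ++ (Γ.trajU (Γ.shiftStrat σ h) k' (fun m => u (M + m)) n).2) := by
  induction n with
  | zero => simp [trajU, hM]
  | succ n ih =>
    rw [← add_assoc]
    simp only [trajU, ih, stepU, shiftStrat, List.append_assoc]

theorem avgU_shift (σ : Γ.Strategy) (k k' : Γ.K) (h : Γ.Hist) (u : ℕ → ℝ) (M : ℕ)
    (hM : Γ.trajU σ k u M = (k', h)) (γ : ℝ)
    (hT : Tendsto (Γ.avgU σ k u) atTop (nhds γ)) :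
    Tendsto (Γ.avgU (Γ.shiftStrat σ h) k' (fun m => u (M + m))) atTop (nhds γ) := by
  set C : ℝ := ∑ m ∈ Finset.range M, Γ.g (Γ.trajU σ k u m).1 (σ (Γ.trajU σ k u m).2) with hC
  have hT' : Tendsto (fun n : ℕ => Γ.avgU σ k u (M + n)) atTop (nhds γ) := by
    have := hT.comp (tendsto_add_atTop_nat M)
    refine this.congr fun n => ?_
    simp [add_comm]
  have h1 : Tendsto (fun n : ℕ => (1 + (M : ℝ) / n)) atTop (nhds (1 + 0)) :=
    tendsto_const_nhds.add (tendsto_const_div_atTop_nhds_zero_nat _)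
  have h2 : Tendsto (fun n : ℕ => C / n) atTop (nhds 0) :=
    tendsto_const_div_atTop_nhds_zero_nat _
  have h3 := (h1.mul hT').sub h2
  rw [add_zero, one_mul, sub_zero] at h3
  refine h3.congr' ?_
  filter_upwards [eventually_gt_atTop 0] with n hn
  have hn' : (n : ℝ) ≠ 0 := by positivity
  have hn'' : ((M : ℝ) + n) ≠ 0 := by positivity
  simp only [avgU]
  rw [Finset.sum_range_add, ← hC]
  simp only [Γ.trajU_shift σ k k' h u M hM]
  push_cast
  simp only [shiftStrat]
  field_simp
  ring

theorem envMeasure_dirac (k : Γ.K) :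
    Γ.envMeasure (diracBelief k) = lam.map (Prod.mk k) := by
  have : vecMeasure (diracBelief k) = Measure.dirac k := by
    unfold vecMeasure diracBelief
    rw [Finset.sum_eq_single k]
    · simp
    · intro b _ hb; simp [hb]
    · simp
  rw [envMeasure, this, Measure.dirac_prod]

theorem shift_tendsto (σ : Γ.Strategy) (k k' : Γ.K) (h : Γ.Hist) (γ : ℝ)
    (hlim : ∀ᵐ x ∂lam, Tendsto (Γ.avgU σ k (unif x)) atTop (nhds γ))
    (hpos : lam {x | Γ.trajU σ k (unif x) h.length = (k', h)} ≠ 0) :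
    ∀ᵐ x ∂lam, Tendsto (Γ.avgU (Γ.shiftStrat σ h) k' (unif x)) atTop (nhds γ) := by
  set M := h.length
  let E : Set ℝ := {x | Γ.trajU σ k (unif x) M = (k', h)}
  let G : Set (ℕ → ℝ) := {u | Tendsto (Γ.avgU (Γ.shiftStrat σ h) k' u) atTop (nhds γ)}
  have hG : MeasurableSet G := measurableSet_tendsto _ fun n => Γ.measurable_avgU _ _ n
  let W : ℝ → ℕ → ℝ := fun x m => unif x (M + m)
  have hWr : Measurable[rowAlg (Set.Ici M)] W := by
    refine (@measurable_pi_iff _ _ _ (rowAlg (Set.Ici M)) _ _).2 fun m => ?_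
    exact unif_rowAlg _ _ (Set.mem_Ici.2 (Nat.le_add_right _ _))
  have hrow : ∀ R, rowAlg R ≤ (inferInstance : MeasurableSpace ℝ) := fun R =>
    iSup₂_le fun i _ => (measurable_digitR i).comap_le
  have hW : Measurable W := hWr.mono (hrow _) le_rfl
  have hU : Measurable (fun x => unif x) := by
    rw [measurable_pi_iff]
    intro m
    exact (unif_rowAlg Set.univ m trivial).mono (hrow _) le_rfl
  have hE : MeasurableSet[rowAlg (Set.Iio M)] E :=
    @measurableSet_trajU Γ ℝ (rowAlg (Set.Iio M)) σ k (fun x => unif x) M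
      (fun m hm => unif_rowAlg _ _ hm) {(k', h)}
  have hind := (Indep_iff _ _ _).1 (indep_rows (Set.Iio M) (Set.Ici M)
    (Set.disjoint_left.2 fun a b c => absurd (Set.mem_Iio.1 b) (not_lt.2 (Set.mem_Ici.1 c)))) E (W ⁻¹' G) hE (hWr hG)
  have h1 : lam (E ∩ W ⁻¹' G) = lam E := by
    refine measure_congr ?_
    filter_upwards [hlim] with x hx
    refine propext ⟨fun a => a.1, fun a => ⟨a, ?_⟩⟩
    exact Γ.avgU_shift σ k k' h (unif x) M a γ hx
  rw [h1] at hind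
  have h2 : lam (W ⁻¹' G) = 1 := by
    have h3 : lam E * 1 = lam E * lam (W ⁻¹' G) := by rw [mul_one]; exact hind
    exact ((ENNReal.mul_right_inj hpos (measure_ne_top _ _)).1 h3).symm
  have h4 : lam ((fun x => unif x) ⁻¹' G) = 1 := by
    rw [← Measure.map_apply hU hG, ← map_unif_shift M, Measure.map_apply hW hG]
    exact h2
  exact (mem_ae_iff_prob_eq_one (hU hG)).2 h4

end POMDP

/-- **Lemma 6.** For every history `h` of positive probability under `σ` starting from
`p*`, every `i` and every `k ∈ B^i[h]`, the `h`-shift satisfies `γ^k_∞(σ[h]) = γ^i_∞`;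
consequently the sets `B^1[h], …, B^r[h]` are pairwise disjoint. -/
theorem pomdp_superSupp_shift_payoff (Γ : POMDP)
    (pstar : Γ.K → ℝ) (hps : IsBelief pstar) (σ : Γ.Strategy)
    (herg : ∀ k, 0 < pstar k →
      ∀ᵐ ω ∂(Γ.envMeasure (diracBelief k)),
        Tendsto (Γ.avg σ ω) atTop (nhds (Γ.payK k σ)))
    (r : ℕ) (Kc : Fin r → Finset Γ.K) (γv : Fin r → ℝ)
    (hKc : ∀ k, 0 < pstar k ↔ ∃ i, k ∈ Kc i)
    (hcl : ∀ i, ∀ k ∈ Kc i, Γ.payK k σ = γv i)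
    (hdist : ∀ i j, i ≠ j → γv i ≠ γv j)
    (hne : ∀ i, (Kc i).Nonempty)
    (h : Γ.Hist) (hh : 0 < Γ.histProb pstar σ h) :
    (∀ i, ∀ k' ∈ Γ.superSuppH σ Kc h i,
      Γ.payK k' (Γ.shiftStrat σ h) = γv i) ∧
    (∀ i j, i ≠ j → Disjoint (Γ.superSuppH σ Kc h i) (Γ.superSuppH σ Kc h j)) := by
  have key : ∀ i, ∀ k' ∈ Γ.superSuppH σ Kc h i,
      Γ.payK k' (Γ.shiftStrat σ h) = γv i := by
    rintro i k' ⟨k, hk, hpos⟩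
    have hps' := herg k ((hKc k).2 ⟨i, hk⟩)
    rw [hcl i k hk, Γ.envMeasure_dirac,
      (measurableEmbedding_prodMk_left k).ae_map_iff] at hps'
    simp only [Γ.avg_eq_avgU] at hps'
    have hne0 : lam {x | Γ.trajU σ k (unif x) h.length = (k', h)} ≠ 0 := by
      intro h0
      apply hpos.ne'
      unfold POMDP.condStateProb POMDP.prob
      rw [Γ.envMeasure_dirac, (measurableEmbedding_prodMk_left k).map_apply]
      have : Prod.mk k ⁻¹' {ω | Γ.hist σ ω h.length = h ∧ Γ.state σ ω h.length = k'}
          = {x | Γ.trajU σ k (unif x) h.length = (k', h)} := by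
        ext x
        simp only [Set.mem_preimage, Set.mem_ofPred_eq, POMDP.hist, POMDP.state,
          Γ.traj_eq_trajU, Prod.ext_iff]
        exact and_comm
      rw [this, h0]
      simp
    have hl := Γ.shift_tendsto σ k k' h (γv i) hps' hne0
    unfold POMDP.payK POMDP.pay
    rw [Γ.envMeasure_dirac]
    have hprob : IsProbabilityMeasure (lam.map (Prod.mk k')) :=
      Measure.isProbabilityMeasure_map measurable_prodMk_left.aemeasurable
    have hc : (fun ω => atTop.liminf (Γ.avg (Γ.shiftStrat σ h) ω))
        =ᵐ[lam.map (Prod.mk k')] fun _ => γv i := by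
      refine ((measurableEmbedding_prodMk_left k').ae_map_iff).2 ?_
      filter_upwards [hl] with x hx
      rw [Γ.avg_eq_avgU]
      exact hx.liminf_eq
    rw [integral_congr_ae hc]
    simp
  refine ⟨key, fun i j hij => Set.disjoint_left.2 fun k' hi hj => hdist i j hij ?_⟩
  rw [← key i k' hi, ← key j k' hj]

end PomdpPaper
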